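/- Let A = −1 and let B ≥ 2 be an integer, let M be the 2×2 real matrix with rows (0, −B) and (1, 1), and let T be the unique nonempty compact subset of ℝ² satisfying M·T + ((B−1)/2, 0) = (⋃_{i=0}^{B−2} (T + (i,0))) ∪ (−T). Then for γ in the p2 group Γ with γ ≠ id, one has T ∩ γ(T) ≠ ∅ if and only if γ is one of the following six isometries: a translation x ↦ x + w with w ∈ {(1,0), (−1,0)}, or a point reflection x ↦ −x + w with w ∈ {(0,0), (−1,0), (−1,1), (0,1)} in case B = 2, respectively w ∈ {(0,0), (1,0), (−1,1), (0,1)} in case B ≥ 3. -/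

import Mathlib

open Set Pointwise

noncomputable section

/-- The plane. -/
abbrev Pt : Type := Fin 2 → ℝ

/-- A planar set is disk-like if it is homeomorphic to the closed unit (Euclidean) disk. -/
def DiskLike (S : Set Pt) : Prop :=
  Nonempty (↥S ≃ₜ ↥(Metric.closedBall (0 : EuclideanSpace ℝ (Fin 2)) 1))

/-- The set equation `M T + ((B-1)/2, 0) = (⋃_{i=0}^{B-2} (T + (i,0))) ∪ (-T)`
for `M = !![0, -B; 1, -A]`. -/
def CrysEq (A B : ℤ) (T : Set Pt) : Prop :=
  (fun x => (!![0, -(B:ℝ); 1, -(A:ℝ)]).mulVec x + ![((B:ℝ)-1)/2, 0]) '' T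
    = (⋃ i ∈ Finset.Icc (0:ℤ) (B-2), (fun x => x + ![(i:ℝ), 0]) '' T) ∪ (-T)

/-- The set equation `M L = ⋃_{i=0}^{B-1} (L + (i,0))` for `M = !![0, -B; 1, -A]`. -/
def LatEq (A B : ℤ) (L : Set Pt) : Prop :=
  (fun x => (!![0, -(B:ℝ); 1, -(A:ℝ)]).mulVec x) '' L
    = ⋃ i ∈ Finset.Icc (0:ℤ) (B-1), (fun x => x + ![(i:ℝ), 0]) '' L

/-- Membership in the crystallographic group p2: maps `x ↦ ε x + (p,q)`,
`ε = ±1`, `p q` integers. -/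
def IsP2 (γ : Pt → Pt) : Prop :=
  ∃ (ε : ℝ) (p q : ℤ), (ε = 1 ∨ ε = -1) ∧ γ = fun x => ε • x + ![(p:ℝ), (q:ℝ)]

/-- If `f` is bounded above on `S` and every `s ∈ S` has a successor `s' ∈ S` with
`a * f s ≤ f s' + b`, where `a > 1`, then `f ≤ b / (a - 1)` on `S`. -/
theorem le_div_of_expanding {ι : Type*} {S : Set ι} {f : ι → ℝ} {a b : ℝ} (ha : 1 < a)
    (hbdd : BddAbove (f '' S)) (h : ∀ s ∈ S, ∃ s' ∈ S, a * f s ≤ f s' + b) {s : ι} (hs : s ∈ S) :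
    f s ≤ b / (a - 1) := by
  have hle : sSup (f '' S) ≤ (sSup (f '' S) + b) / a := by
    refine csSup_le ⟨_, mem_image_of_mem f hs⟩ ?_
    rintro _ ⟨u, hu, rfl⟩
    obtain ⟨u', hu', hle⟩ := h u hu
    have := le_csSup hbdd (mem_image_of_mem f hu')
    rw [le_div_iff₀ (by linarith)]
    linarith
  rw [le_div_iff₀ (by linarith)] at hle
  have := le_csSup hbdd (mem_image_of_mem f hs)
  rw [le_div_iff₀ (by linarith)]
  nlinarith

theorem nonpos_of_eq_mul_mul_mul {b u v : ℝ} (hb : 2 ≤ b) (h : u = b * (b * (b * v)))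
    (hu : 0 ≤ u) (huv : u ≤ v) : u ≤ 0 := by
  have h1 : 2 * v ≤ b * v := mul_le_mul_of_nonneg_right hb (hu.trans huv)
  have h2 : b * v ≤ b * (b * v) := le_mul_of_one_le_left (by linarith) (by linarith)
  have h3 : b * (b * v) ≤ b * (b * (b * v)) :=
    le_mul_of_one_le_left (by linarith) (by linarith)
  linarith

/-- `T` meets its translate by `(p, q)`. -/
def MeetsTranslate (T : Set Pt) (p q : ℤ) : Prop :=
  ∃ z ∈ T, ∃ y ∈ T, z 0 = y 0 + p ∧ z 1 = y 1 + q

/-- `T` meets its image under the point reflection `x ↦ -x + (p, q)`. -/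
def MeetsReflection (T : Set Pt) (p q : ℤ) : Prop :=
  ∃ z ∈ T, ∃ y ∈ T, z 0 = -y 0 + p ∧ z 1 = -y 1 + q

theorem meetsTranslate_iff (T : Set Pt) (p q : ℤ) :
    (T ∩ (fun x : Pt => x + ![(p:ℝ), (q:ℝ)]) '' T).Nonempty ↔ MeetsTranslate T p q := by
  constructor
  · rintro ⟨_, hz, y, hy, rfl⟩
    exact ⟨_, hz, y, hy, by simp, by simp⟩
  · rintro ⟨z, hz, y, hy, h0, h1⟩
    refine ⟨z, hz, y, hy, ?_⟩
    ext i
    fin_cases i <;> simp [h0, h1]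

theorem meetsReflection_iff (T : Set Pt) (p q : ℤ) :
    (T ∩ (fun x : Pt => -x + ![(p:ℝ), (q:ℝ)]) '' T).Nonempty ↔ MeetsReflection T p q := by
  constructor
  · rintro ⟨_, hz, y, hy, rfl⟩
    exact ⟨_, hz, y, hy, by simp, by simp⟩
  · rintro ⟨z, hz, y, hy, h0, h1⟩
    refine ⟨z, hz, y, hy, ?_⟩
    ext i
    fin_cases i <;> simp [h0, h1]

theorem MeetsTranslate.neg {T : Set Pt} {p q : ℤ} (h : MeetsTranslate T p q) :
    MeetsTranslate T (-p) (-q) := by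
  obtain ⟨z, hz, y, hy, h0, h1⟩ := h
  exact ⟨y, hy, z, hz, by push_cast; linarith, by push_cast; linarith⟩

namespace CrysEq

variable {B : ℤ} {T : Set Pt}

theorem expand (hT : CrysEq (-1) B T) {x : Pt} (hx : x ∈ T) :
    (∃ i : ℤ, 0 ≤ i ∧ i ≤ B - 2 ∧ ∃ y ∈ T,
      -(B:ℝ) * x 1 + ((B:ℝ) - 1) / 2 = y 0 + i ∧ x 0 + x 1 = y 1) ∨
    ∃ y ∈ T, -(B:ℝ) * x 1 + ((B:ℝ) - 1) / 2 = -y 0 ∧ x 0 + x 1 = -y 1 := by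
  have h := hT.subset (mem_image_of_mem _ hx)
  rcases h with h | h
  · simp only [mem_iUnion, Finset.mem_Icc] at h
    obtain ⟨i, ⟨hi0, hi1⟩, y, hy, hxy⟩ := h
    refine Or.inl ⟨i, hi0, hi1, y, hy, ?_, ?_⟩
    · simpa [Matrix.mulVec, dotProduct, Fin.sum_univ_two] using (congrFun hxy 0).symm
    · simpa [Matrix.mulVec, dotProduct, Fin.sum_univ_two] using (congrFun hxy 1).symm
  · refine Or.inr ⟨_, h, ?_, ?_⟩ <;> simp [dotProduct, Fin.sum_univ_two]

theorem exists_preimage_add (hT : CrysEq (-1) B T) {y : Pt} (hy : y ∈ T) (i : ℤ) (hi0 : 0 ≤ i)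
    (hi1 : i ≤ B - 2) :
    ∃ x ∈ T, -(B:ℝ) * x 1 + ((B:ℝ) - 1) / 2 = y 0 + i ∧ x 0 + x 1 = y 1 := by
  have hmem : y + ![(i:ℝ), 0] ∈ (⋃ i ∈ Finset.Icc (0:ℤ) (B-2),
      (fun x : Pt => x + ![(i:ℝ), 0]) '' T) ∪ (-T) := by
    left
    simp only [mem_iUnion, Finset.mem_Icc]
    exact ⟨i, ⟨hi0, hi1⟩, y, hy, rfl⟩
  obtain ⟨x, hx, hxy⟩ := hT.superset hmem
  refine ⟨x, hx, ?_, ?_⟩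
  · simpa [Matrix.mulVec, dotProduct, Fin.sum_univ_two] using congrFun hxy 0
  · simpa [Matrix.mulVec, dotProduct, Fin.sum_univ_two] using congrFun hxy 1

theorem exists_preimage_neg (hT : CrysEq (-1) B T) {y : Pt} (hy : y ∈ T) :
    ∃ x ∈ T, -(B:ℝ) * x 1 + ((B:ℝ) - 1) / 2 = -y 0 ∧ x 0 + x 1 = -y 1 := by
  have hmem : -y ∈ (⋃ i ∈ Finset.Icc (0:ℤ) (B-2),
      (fun x : Pt => x + ![(i:ℝ), 0]) '' T) ∪ (-T) := by
    right
    simpa using hy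
  obtain ⟨x, hx, hxy⟩ := hT.superset hmem
  refine ⟨x, hx, ?_, ?_⟩
  · simpa [Matrix.mulVec, dotProduct, Fin.sum_univ_two] using congrFun hxy 0
  · simpa [Matrix.mulVec, dotProduct, Fin.sum_univ_two] using congrFun hxy 1

theorem translate_succ (hT : CrysEq (-1) B T) {p q : ℤ} (h : MeetsTranslate T p q) :
    (∃ k, -(B - 2) ≤ k ∧ k ≤ B - 2 ∧ MeetsTranslate T (-B * q + k) (p + q)) ∨
    MeetsTranslate T (B * q) (-p - q) ∨
    (∃ i, 0 ≤ i ∧ i ≤ B - 2 ∧ MeetsReflection T (-B * q - i) (p + q)) ∨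
    ∃ i, 0 ≤ i ∧ i ≤ B - 2 ∧ MeetsReflection T (B * q - i) (-p - q) := by
  obtain ⟨z, hz, y, hy, h0, h1⟩ := h
  rcases hT.expand hz with ⟨i, hi0, hi1, z', hz', e0, e1⟩ | ⟨z', hz', e0, e1⟩ <;>
  rcases hT.expand hy with ⟨j, hj0, hj1, y', hy', f0, f1⟩ | ⟨y', hy', f0, f1⟩ <;>
  rw [h1] at e0
  · refine Or.inl ⟨j - i, by omega, by omega, z', hz', y', hy', ?_, ?_⟩ <;> push_cast <;> linarith
  · refine Or.inr (Or.inr (Or.inl ⟨i, hi0, hi1, z', hz', y', hy', ?_, ?_⟩)) <;>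
      push_cast <;> linarith
  · refine Or.inr (Or.inr (Or.inr ⟨j, hj0, hj1, z', hz', y', hy', ?_, ?_⟩)) <;>
      push_cast <;> linarith
  · refine Or.inr (Or.inl ⟨z', hz', y', hy', ?_, ?_⟩) <;> push_cast <;> linarith

theorem reflection_succ (hT : CrysEq (-1) B T) {p q : ℤ} (h : MeetsReflection T p q) :
    (∃ k, -(B - 3) ≤ k ∧ k ≤ B - 1 ∧ MeetsReflection T (-B * q + k) (p + q)) ∨
    MeetsReflection T (B * q - (B - 1)) (-p - q) ∨
    (∃ k, 1 ≤ k ∧ k ≤ B - 1 ∧ MeetsTranslate T (-B * q + k) (p + q)) ∨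
    ∃ k, 1 ≤ k ∧ k ≤ B - 1 ∧ MeetsTranslate T (B * q - k) (-p - q) := by
  obtain ⟨z, hz, y, hy, h0, h1⟩ := h
  rcases hT.expand hz with ⟨i, hi0, hi1, z', hz', e0, e1⟩ | ⟨z', hz', e0, e1⟩ <;>
  rcases hT.expand hy with ⟨j, hj0, hj1, y', hy', f0, f1⟩ | ⟨y', hy', f0, f1⟩ <;>
  rw [h1] at e0
  · refine Or.inl ⟨B - 1 - i - j, by omega, by omega, z', hz', y', hy', ?_, ?_⟩ <;>
      push_cast <;> linarith
  · refine Or.inr (Or.inr (Or.inl ⟨B - 1 - i, by omega, by omega, z', hz', y', hy', ?_, ?_⟩)) <;>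
      push_cast <;> linarith
  · refine Or.inr (Or.inr (Or.inr ⟨B - 1 - j, by omega, by omega, z', hz', y', hy', ?_, ?_⟩)) <;>
      push_cast <;> linarith
  · refine Or.inr (Or.inl ⟨z', hz', y', hy', ?_, ?_⟩) <;> push_cast <;> linarith

/-- Every neighbour vector has a successor under the expansion, up to sign. -/
theorem exists_succ (hT : CrysEq (-1) B T) (hB : 2 ≤ B) {p q : ℤ}
    (h : MeetsTranslate T p q ∨ MeetsReflection T p q) :
    ∃ p' q', (MeetsTranslate T p' q' ∨ MeetsReflection T p' q') ∧
      ∃ k, |k| ≤ B - 1 ∧ (p' = -B * q + k ∧ q' = p + q ∨ -p' = -B * q + k ∧ -q' = p + q) := by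
  simp only [abs_le]
  rcases h with h | h
  · rcases hT.translate_succ h with ⟨k, _, _, h'⟩ | h' | ⟨k, _, _, h'⟩ | ⟨k, _, _, h'⟩
    · exact ⟨_, _, Or.inl h', k, by omega, Or.inl ⟨by ring, by ring⟩⟩
    · exact ⟨_, _, Or.inl h', 0, by omega, Or.inr ⟨by ring, by ring⟩⟩
    · exact ⟨_, _, Or.inr h', -k, by omega, Or.inl ⟨by ring, by ring⟩⟩
    · exact ⟨_, _, Or.inr h', k, by omega, Or.inr ⟨by ring, by ring⟩⟩
  · rcases hT.reflection_succ h with ⟨k, _, _, h'⟩ | h' | ⟨k, _, _, h'⟩ | ⟨k, _, _, h'⟩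
    · exact ⟨_, _, Or.inr h', k, by omega, Or.inl ⟨by ring, by ring⟩⟩
    · exact ⟨_, _, Or.inr h', B - 1, by omega, Or.inr ⟨by ring, by ring⟩⟩
    · exact ⟨_, _, Or.inl h', k, by omega, Or.inl ⟨by ring, by ring⟩⟩
    · exact ⟨_, _, Or.inl h', k, by omega, Or.inr ⟨by ring, by ring⟩⟩

end CrysEq

/-- A root of `X ^ 2 - X + B`, an eigenvalue of the expansion matrix. -/
def expansionRoot (B : ℤ) : ℂ := ⟨1 / 2, √(4 * B - 1) / 2⟩

theorem expansionRoot_sq {B : ℤ} (hB : 2 ≤ B) :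
    expansionRoot B ^ 2 = expansionRoot B - B := by
  have hB' : (2:ℝ) ≤ B := by exact_mod_cast hB
  have hs : √(4 * (B:ℝ) - 1) * √(4 * B - 1) = 4 * B - 1 := Real.mul_self_sqrt (by linarith)
  rw [sq]
  apply Complex.ext <;> simp [expansionRoot] <;> linarith

theorem norm_expansionRoot {B : ℤ} (hB : 2 ≤ B) : ‖expansionRoot B‖ = √(B:ℝ) := by
  have hB' : (2:ℝ) ≤ B := by exact_mod_cast hB
  have hs : √(4 * (B:ℝ) - 1) * √(4 * B - 1) = 4 * B - 1 := Real.mul_self_sqrt (by linarith)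
  rw [Complex.norm_def]
  congr 1
  simp [expansionRoot, Complex.normSq_apply]
  linarith

namespace CrysEq

variable {B : ℤ} {T : Set Pt}

theorem bddAbove_norm_neighbour (hTc : IsCompact T) (a : ℂ) :
    BddAbove ((fun w : ℤ × ℤ => ‖(w.1 + w.2 * a : ℂ)‖) ''
      {w | MeetsTranslate T w.1 w.2 ∨ MeetsReflection T w.1 w.2}) := by
  obtain ⟨C, hC⟩ := hTc.isBounded.exists_norm_le
  have hcoord : ∀ z ∈ T, ∀ i, |z i| ≤ C := fun z hz i =>
    (norm_le_pi_norm z i).trans (hC z hz)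
  refine ⟨2 * C + 2 * C * ‖a‖, ?_⟩
  rintro _ ⟨⟨p, q⟩, hw, rfl⟩
  have hpq : |(p:ℝ)| ≤ 2 * C ∧ |(q:ℝ)| ≤ 2 * C := by
    rcases hw with ⟨z, hz, y, hy, h0, h1⟩ | ⟨z, hz, y, hy, h0, h1⟩ <;>
    · have a0 := abs_le.1 (hcoord z hz 0)
      have a1 := abs_le.1 (hcoord z hz 1)
      have b0 := abs_le.1 (hcoord y hy 0)
      have b1 := abs_le.1 (hcoord y hy 1)
      dsimp only at h0 h1
      constructor <;> rw [abs_le] <;> constructor <;> linarith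
  refine (norm_add_le _ _).trans ?_
  rw [norm_mul, Complex.norm_intCast, Complex.norm_intCast]
  gcongr
  exacts [hpq.1, hpq.2]

theorem abs_snd_le_one (hT : CrysEq (-1) B T) (hB : 2 ≤ B) (hTc : IsCompact T) {p q : ℤ}
    (h : MeetsTranslate T p q ∨ MeetsReflection T p q) : |q| ≤ 1 := by
  have hB' : (2:ℝ) ≤ B := by exact_mod_cast hB
  have hsB : √(B:ℝ) * √B = B := Real.mul_self_sqrt (by linarith)
  have h1 : 1 < √(B:ℝ) := by
    rw [Real.lt_sqrt zero_le_one]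
    linarith
  have hle := le_div_of_expanding (a := √(B:ℝ)) (b := B - 1) h1
    (bddAbove_norm_neighbour hTc (expansionRoot B)) ?_ (s := (p, q)) h
  · rw [show (B:ℝ) - 1 = (√B + 1) * (√B - 1) by linarith,
      mul_div_cancel_right₀ _ (by linarith)] at hle
    have him := (Complex.abs_im_le_norm _).trans hle
    have hs : √(4 * (B:ℝ) - 1) * √(4 * B - 1) = 4 * B - 1 := Real.mul_self_sqrt (by linarith)
    have hs0 := Real.sqrt_nonneg (4 * (B:ℝ) - 1)
    simp only [expansionRoot, Complex.add_im, Complex.mul_im, Complex.intCast_im,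
      Complex.intCast_re, zero_mul, zero_add, add_zero, abs_mul] at him
    rw [abs_of_nonneg (by positivity : (0:ℝ) ≤ √(4 * B - 1) / 2)] at him
    by_contra! hq
    have hq' : (2:ℝ) ≤ |(q:ℝ)| := by exact_mod_cast hq
    have : √(4 * (B:ℝ) - 1) ≤ √B + 1 := by nlinarith
    nlinarith
  · rintro ⟨p, q⟩ hw
    obtain ⟨p', q', hw', k, hk, hpq⟩ := hT.exists_succ hB hw
    refine ⟨(p', q'), hw', ?_⟩
    have hk' : ‖(k:ℂ)‖ ≤ B - 1 := by
      rw [Complex.norm_intCast]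
      exact_mod_cast hk
    have hmul : expansionRoot B * (p + q * expansionRoot B)
        = ((-B * q + k : ℤ) + (p + q : ℤ) * expansionRoot B) - k := by
      push_cast
      linear_combination (q:ℂ) * expansionRoot_sq hB
    have hnorm : ‖((-B * q + k : ℤ) + (p + q : ℤ) * expansionRoot B : ℂ)‖
        = ‖(p' + q' * expansionRoot B : ℂ)‖ := by
      rcases hpq with ⟨e0, e1⟩ | ⟨e0, e1⟩
      · rw [e0, e1]
      · rw [← e0, ← e1, ← norm_neg]
        congr 1
        push_cast
        ring
    dsimp only
    rw [← norm_expansionRoot hB, ← norm_mul, hmul, ← hnorm]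
    exact (norm_sub_le _ _).trans (by gcongr)

theorem abs_add_le_one (hT : CrysEq (-1) B T) (hB : 2 ≤ B) (hTc : IsCompact T) {p q : ℤ}
    (h : MeetsTranslate T p q ∨ MeetsReflection T p q) : |p + q| ≤ 1 := by
  obtain ⟨p', q', hw', k, -, hpq⟩ := hT.exists_succ hB h
  have := hT.abs_snd_le_one hB hTc hw'
  rw [abs_le] at this ⊢
  omega

theorem abs_fst_le_one (hT : CrysEq (-1) B T) (hB : 2 ≤ B) (hTc : IsCompact T) {p q : ℤ}
    (h : MeetsTranslate T p q ∨ MeetsReflection T p q) : |p| ≤ 1 := by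
  have box : ∀ {p q : ℤ}, MeetsTranslate T p q ∨ MeetsReflection T p q →
      (-1 ≤ q ∧ q ≤ 1) ∧ -1 ≤ p + q ∧ p + q ≤ 1 := fun h =>
    ⟨abs_le.1 (hT.abs_snd_le_one hB hTc h), abs_le.1 (hT.abs_add_le_one hB hTc h)⟩
  obtain ⟨⟨hq0, hq1⟩, hpq⟩ := box h
  rw [abs_le]
  rcases h with h | h
  · rcases hT.translate_succ h with ⟨k, _, _, h'⟩ | h' | ⟨k, _, _, h'⟩ | ⟨k, _, _, h'⟩
    · have := box (Or.inl h')
      interval_cases q <;> omega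
    · have := box (Or.inl h')
      interval_cases q <;> omega
    · have := box (Or.inr h')
      interval_cases q <;> omega
    · have := box (Or.inr h')
      interval_cases q <;> omega
  · rcases hT.reflection_succ h with ⟨k, _, _, h'⟩ | h' | ⟨k, _, _, h'⟩ | ⟨k, _, _, h'⟩
    · have := box (Or.inr h')
      interval_cases q <;> omega
    · have := box (Or.inr h')
      interval_cases q <;> omega
    · have := box (Or.inl h')
      interval_cases q <;> omega
    · have := box (Or.inl h')
      interval_cases q <;> omega

theorem snd_eq_zero_of_meetsTranslate (hT : CrysEq (-1) B T) (hB : 2 ≤ B) (hTc : IsCompact T)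
    {p q : ℤ} (h : MeetsTranslate T p q) : q = 0 := by
  obtain ⟨hq0, hq1⟩ := abs_le.1 (hT.abs_snd_le_one hB hTc (Or.inl h))
  rcases hT.translate_succ h with ⟨k, _, _, h'⟩ | h' | ⟨k, _, _, h'⟩ | ⟨k, _, _, h'⟩
  · have := abs_le.1 (hT.abs_fst_le_one hB hTc (Or.inl h'))
    interval_cases q <;> omega
  · have := abs_le.1 (hT.abs_fst_le_one hB hTc (Or.inl h'))
    interval_cases q <;> omega
  · have := abs_le.1 (hT.abs_fst_le_one hB hTc (Or.inr h'))
    interval_cases q <;> omega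
  · have := abs_le.1 (hT.abs_fst_le_one hB hTc (Or.inr h'))
    interval_cases q <;> omega

theorem snd_nonneg_of_meetsReflection (hT : CrysEq (-1) B T) (hB : 2 ≤ B) (hTc : IsCompact T)
    {p q : ℤ} (h : MeetsReflection T p q) : 0 ≤ q := by
  obtain ⟨hq0, hq1⟩ := abs_le.1 (hT.abs_snd_le_one hB hTc (Or.inr h))
  rcases hT.reflection_succ h with ⟨k, _, _, h'⟩ | h' | ⟨k, _, _, h'⟩ | ⟨k, _, _, h'⟩
  · have := abs_le.1 (hT.abs_fst_le_one hB hTc (Or.inr h'))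
    interval_cases q <;> omega
  · have := abs_le.1 (hT.abs_fst_le_one hB hTc (Or.inr h'))
    interval_cases q <;> omega
  · have := abs_le.1 (hT.abs_fst_le_one hB hTc (Or.inl h'))
    interval_cases q <;> omega
  · have := abs_le.1 (hT.abs_fst_le_one hB hTc (Or.inl h'))
    interval_cases q <;> omega

theorem eq_of_meetsReflection (hT : CrysEq (-1) B T) (hB : 2 ≤ B) (hTc : IsCompact T)
    {p q : ℤ} (h : MeetsReflection T p q) :
    p = 0 ∧ q = 0 ∨ p = -1 ∧ q = 1 ∨ p = 0 ∧ q = 1 ∨ B = 2 ∧ p = -1 ∧ q = 0 ∨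
      3 ≤ B ∧ p = 1 ∧ q = 0 := by
  have hq0 := hT.snd_nonneg_of_meetsReflection hB hTc h
  have hq1 := (abs_le.1 (hT.abs_snd_le_one hB hTc (Or.inr h))).2
  have hp := abs_le.1 (hT.abs_fst_le_one hB hTc (Or.inr h))
  have hpq := abs_le.1 (hT.abs_add_le_one hB hTc (Or.inr h))
  rcases hT.reflection_succ h with ⟨k, _, _, h'⟩ | h' | ⟨k, _, _, h'⟩ | ⟨k, _, _, h'⟩
  · have := hT.snd_nonneg_of_meetsReflection hB hTc h'
    have := abs_le.1 (hT.abs_add_le_one hB hTc (Or.inr h'))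
    interval_cases q <;> omega
  · have := hT.snd_nonneg_of_meetsReflection hB hTc h'
    have := abs_le.1 (hT.abs_fst_le_one hB hTc (Or.inr h'))
    interval_cases q <;> omega
  · have := hT.snd_eq_zero_of_meetsTranslate hB hTc h'
    interval_cases q <;> omega
  · have := hT.snd_eq_zero_of_meetsTranslate hB hTc h'
    interval_cases q <;> omega

/-- A closest pair for the translation `(1, 0)` can be pulled back along the cycle
`(1, 0) → -x + (0, 1) → -x + (-1, 1) → (1, 0)`, which shrinks its distance. -/
theorem meetsTranslate_one_zero (hT : CrysEq (-1) B T) (hB : 2 ≤ B) (hTc : IsCompact T)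
    (hTne : T.Nonempty) : MeetsTranslate T 1 0 := by
  have hB' : (2:ℝ) ≤ B := by exact_mod_cast hB
  let Q : ℝ → ℝ → ℝ := fun x y => x ^ 2 + x * y + B * y ^ 2
  have hQ : ∀ {x y u v : ℝ}, u = -B * y → v = x + y → Q u v = B * Q x y := by
    rintro x y _ _ rfl rfl
    simp only [Q]
    ring
  have hQneg : ∀ x y, Q (-x) (-y) = Q x y := fun x y => by simp only [Q]; ring
  obtain ⟨⟨z, y⟩, ⟨hz, hy⟩, hmin⟩ := (hTc.prod hTc).exists_isMinOn (hTne.prod hTne)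
    (f := fun v : Pt × Pt => Q (v.1 0 - v.2 0 - 1) (v.1 1 - v.2 1))
    (Continuous.continuousOn (by fun_prop))
  obtain ⟨z₂, hz₂, a0, a1⟩ := hT.exists_preimage_neg hz
  obtain ⟨y₂, hy₂, b0, b1⟩ := hT.exists_preimage_add hy 0 le_rfl (by omega)
  obtain ⟨z₁, hz₁, c0, c1⟩ := hT.exists_preimage_add hz₂ 0 le_rfl (by omega)
  obtain ⟨y₁, hy₁, d0, d1⟩ := hT.exists_preimage_add hy₂ 0 le_rfl (by omega)
  obtain ⟨z₀, hz₀, e0, e1⟩ := hT.exists_preimage_add hz₁ 0 le_rfl (by omega)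
  obtain ⟨y₀, hy₀, f0, f1⟩ := hT.exists_preimage_neg hy₁
  push_cast at b0 c0 d0 e0
  have g := hmin (show (z₀, y₀) ∈ T ×ˢ T from ⟨hz₀, hy₀⟩)
  simp only [mem_ofPred_eq] at g
  have q0 : Q (z₁ 0 + y₁ 0) (z₁ 1 + y₁ 1 - 1) = B * Q (z₀ 0 - y₀ 0 - 1) (z₀ 1 - y₀ 1) :=
    hQ (by linarith) (by linarith)
  have q1 : Q (z₂ 0 + y₂ 0 + 1) (z₂ 1 + y₂ 1 - 1) = B * Q (z₁ 0 + y₁ 0) (z₁ 1 + y₁ 1 - 1) :=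
    hQ (by linarith) (by linarith)
  have q2 : Q (-(z 0 - y 0 - 1)) (-(z 1 - y 1)) = B * Q (z₂ 0 + y₂ 0 + 1) (z₂ 1 + y₂ 1 - 1) :=
    hQ (by linarith) (by linarith)
  rw [hQneg, q1, q0] at q2
  have hform : ∀ x y, Q x y = (x + y / 2) ^ 2 + (B - 1 / 4) * y ^ 2 := fun x y => by
    simp only [Q]; ring
  have hQnn : ∀ x y, 0 ≤ Q x y := fun x y => by
    rw [hform]
    have : (0:ℝ) ≤ B - 1 / 4 := by linarith
    positivity
  have hzero : Q (z 0 - y 0 - 1) (z 1 - y 1) = 0 := by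
    have h0 := hQnn (z 0 - y 0 - 1) (z 1 - y 1)
    exact le_antisymm (nonpos_of_eq_mul_mul_mul hB' q2 h0 g) h0
  rw [hform] at hzero
  have hB4 : (0:ℝ) < B - 1 / 4 := by linarith
  obtain ⟨hzero, hv⟩ := (add_eq_zero_iff_of_nonneg (sq_nonneg _)
    (mul_nonneg hB4.le (sq_nonneg _))).1 hzero
  replace hv := (mul_eq_zero.1 hv).resolve_left hB4.ne'
  have hv' := pow_eq_zero_iff two_ne_zero |>.1 hv
  have hu' := pow_eq_zero_iff two_ne_zero |>.1 hzero
  exact ⟨z, hz, y, hy, by push_cast; linarith, by push_cast; linarith⟩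

theorem meetsReflection_of_eq (hB : 2 ≤ B) {p q : ℤ} {z y : Pt} (hz : z ∈ T) (hy : y ∈ T)
    (h0 : -(B:ℝ) * (z 1 + y 1) = -B * q) (h1 : z 0 + z 1 + (y 0 + y 1) = p + q) :
    MeetsReflection T p q := by
  have hB' : (B:ℝ) ≠ 0 := by
    have : B ≠ 0 := by omega
    exact_mod_cast this
  have := mul_left_cancel₀ (neg_ne_zero.2 hB') h0
  exact ⟨z, hz, y, hy, by linarith, by linarith⟩

theorem meetsReflection_zero_zero (hT : CrysEq (-1) B T) (hB : 2 ≤ B)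
    (h : MeetsTranslate T 1 0) : MeetsReflection T 0 0 := by
  obtain ⟨z, hz, y, hy, h0, h1⟩ := h
  obtain ⟨z', hz', a0, a1⟩ := hT.exists_preimage_add hz (B - 2) (by omega) le_rfl
  obtain ⟨y', hy', b0, b1⟩ := hT.exists_preimage_neg hy
  push_cast at h0 h1 a0
  exact meetsReflection_of_eq hB hz' hy' (by push_cast; linarith) (by push_cast; linarith)

theorem meetsReflection_neg_one_one (hT : CrysEq (-1) B T) (hB : 2 ≤ B)
    (h : MeetsTranslate T 1 0) : MeetsReflection T (-1) 1 := by
  obtain ⟨z, hz, y, hy, h0, h1⟩ := h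
  obtain ⟨z', hz', a0, a1⟩ := hT.exists_preimage_neg hz
  obtain ⟨y', hy', b0, b1⟩ := hT.exists_preimage_add hy 0 le_rfl (by omega)
  push_cast at h0 h1 b0
  exact meetsReflection_of_eq hB hz' hy' (by push_cast; linarith) (by push_cast; linarith)

theorem meetsReflection_zero_one (hT : CrysEq (-1) B T) (hB : 2 ≤ B)
    (h : MeetsReflection T (-1) 1) : MeetsReflection T 0 1 := by
  obtain ⟨z, hz, y, hy, h0, h1⟩ := h
  obtain ⟨z', hz', a0, a1⟩ := hT.exists_preimage_add hz 0 le_rfl (by omega)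
  obtain ⟨y', hy', b0, b1⟩ := hT.exists_preimage_add hy 0 le_rfl (by omega)
  push_cast at h0 h1 a0 b0
  exact meetsReflection_of_eq hB hz' hy' (by push_cast; linarith) (by push_cast; linarith)

theorem meetsReflection_neg_one_zero (hT : CrysEq (-1) 2 T)
    (h : MeetsReflection T (-1) 1) : MeetsReflection T (-1) 0 := by
  obtain ⟨z, hz, y, hy, h0, h1⟩ := h
  obtain ⟨z', hz', a0, a1⟩ := hT.exists_preimage_neg hz
  obtain ⟨y', hy', b0, b1⟩ := hT.exists_preimage_neg hy
  push_cast at h0 h1 a0 b0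
  exact meetsReflection_of_eq le_rfl hz' hy' (by push_cast; linarith) (by push_cast; linarith)

theorem meetsReflection_one_zero (hT : CrysEq (-1) B T) (hB : 3 ≤ B)
    (h : MeetsReflection T 0 1) : MeetsReflection T 1 0 := by
  obtain ⟨z, hz, y, hy, h0, h1⟩ := h
  obtain ⟨z', hz', a0, a1⟩ := hT.exists_preimage_add hz (B - 2) (by omega) le_rfl
  obtain ⟨y', hy', b0, b1⟩ := hT.exists_preimage_add hy 1 zero_le_one (by omega)
  push_cast at h0 h1 a0 b0
  exact meetsReflection_of_eq (B := B) (by omega) hz' hy' (by push_cast; linarith) (by push_cast; linarith)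

end CrysEq

theorem stmt_13 (B : ℤ) (hB : 2 ≤ B)
    (T : Set Pt) (hTne : T.Nonempty) (hTc : IsCompact T) (hT : CrysEq (-1) B T) :
    (∀ p q : ℤ, ¬(p = 0 ∧ q = 0) →
      ((T ∩ (fun x : Pt => x + ![(p:ℝ), (q:ℝ)]) '' T).Nonempty ↔
        (p, q) ∈ ({(1,0), (-1,0)} : Set (ℤ × ℤ)))) ∧
    (∀ p q : ℤ,
      ((T ∩ (fun x : Pt => -x + ![(p:ℝ), (q:ℝ)]) '' T).Nonempty ↔
        ((B = 2 ∧ (p, q) ∈ ({(0,0), (-1,0), (-1,1), (0,1)} : Set (ℤ × ℤ))) ∨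
         (3 ≤ B ∧ (p, q) ∈ ({(0,0), (1,0), (-1,1), (0,1)} : Set (ℤ × ℤ)))))) := by
  have t := hT.meetsTranslate_one_zero hB hTc hTne
  have r := hT.meetsReflection_neg_one_one hB t
  have r' := hT.meetsReflection_zero_one hB r
  have r₀ := hT.meetsReflection_zero_zero hB t
  simp only [meetsTranslate_iff, meetsReflection_iff, mem_insert_iff, mem_singleton_iff,
    Prod.mk.injEq]
  refine ⟨fun p q hpq => ⟨fun h => ?_, ?_⟩, fun p q => ⟨fun h => ?_, ?_⟩⟩
  · have := hT.snd_eq_zero_of_meetsTranslate hB hTc h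
    have := abs_le.1 (hT.abs_fst_le_one hB hTc (Or.inl h))
    omega
  · rintro (⟨rfl, rfl⟩ | ⟨rfl, rfl⟩)
    exacts [t, t.neg]
  · have := hT.eq_of_meetsReflection hB hTc h
    omega
  · rintro (⟨rfl, ⟨rfl, rfl⟩ | ⟨rfl, rfl⟩ | ⟨rfl, rfl⟩ | ⟨rfl, rfl⟩⟩ |
      ⟨hB3, ⟨rfl, rfl⟩ | ⟨rfl, rfl⟩ | ⟨rfl, rfl⟩ | ⟨rfl, rfl⟩⟩)
    exacts [r₀, hT.meetsReflection_neg_one_zero r, r, r', r₀,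
      hT.meetsReflection_one_zero hB3 r', r, r']
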